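/- Let $d\ge 1$, $0<\lambda<d/2$, $\alpha\ge 0$, and $b\in L^1(\mathbb{S}^{d-1})$ nonnegative. Define the loss operator $Q^-(f,g)(v)=\|b\|_{L^1(\mathbb{S}^{d-1})}\,f(v)\int_{\mathbb{R}^d}|v-v_*|^{-\lambda}g(v_*)\,dv_*$. Then there exists $C=C(\alpha,\lambda,d)$ such that for all $f,g\in L^1\cap\dot H^\alpha(\mathbb{R}^d)$, $\|Q^-(f,g)\|_{\dot H^\alpha} \le C\,\|b\|_{L^1(\mathbb{S}^{d-1})}\bigl\{\|f\|_{\dot H^\alpha}\|g\|_{L^1}^{1-\theta}\|g\|_{\dot H^\alpha}^{\theta} + \|f\|_{L^1}^{1-\delta}\|f\|_{\dot H^\alpha}^{\delta}\|g\|_{L^1}^{1-\gamma}\|g\|_{\dot H^\alpha}^{\gamma}\bigr\}$ with $\theta=\frac{2\lambda}{d+2\alpha}$, $\delta=\frac{d}{d+2\alpha}$, $\gamma=\frac{2\lambda+2\alpha}{d+2\alpha}$. -/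

import Mathlib

open MeasureTheory FourierTransform ENNReal
open scoped NNReal

noncomputable def L1e (d : ℕ) (f : EuclideanSpace ℝ (Fin d) → ℂ) : ℝ≥0∞ :=
  ∫⁻ v, ‖f v‖₊

noncomputable def He (d : ℕ) (s : ℝ) (f : EuclideanSpace ℝ (Fin d) → ℂ) : ℝ≥0∞ :=
  (∫⁻ ξ, (‖ξ‖₊ : ℝ≥0∞) ^ (2 * s) * (‖𝓕 f ξ‖₊ : ℝ≥0∞) ^ (2 : ℝ)) ^ ((1 : ℝ) / 2)

/-- The loss operator Q⁻ with fractional kernel, where c stands for ‖b‖_{L¹(S^{d-1})}. -/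
noncomputable def Qminus (d : ℕ) (c lam : ℝ)
    (f g : EuclideanSpace ℝ (Fin d) → ℂ) (v : EuclideanSpace ℝ (Fin d)) : ℂ :=
  (c : ℂ) * f v * ∫ w, ((‖v - w‖ ^ (-lam) : ℝ) : ℂ) * g w

/-- Surface measure on the unit sphere in ℝ^d. -/
noncomputable def sph (d : ℕ) : Measure (EuclideanSpace ℝ (Fin d)) :=
  (μH[(d : ℝ) - 1]).restrict (Metric.sphere 0 1)

open scoped RealInnerProductSpace in
noncomputable def bL1 (d : ℕ) (b : ℝ → ℝ) (k : EuclideanSpace ℝ (Fin d)) : ℝ≥0∞ :=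
  ∫⁻ σ, ENNReal.ofReal (b ⟪k, σ⟫) ∂sph d

theorem lintegral_eq_mul_lintegral_comp_smul (d : ℕ) (F : EuclideanSpace ℝ (Fin d) → ℝ≥0∞)
    {r : ℝ} (hr : 0 < r) :
    ∫⁻ x, F x = ENNReal.ofReal r ^ (d : ℝ) * ∫⁻ x, F (r • x) := by
  have h := Measure.map_addHaar_smul (volume : Measure (EuclideanSpace ℝ (Fin d))) hr.ne'
  have he : ∫⁻ x, F (r • x) = ∫⁻ x, F x ∂(Measure.map (r • ·) volume) := by
    rw [show (fun x : EuclideanSpace ℝ (Fin d) => r • x) =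
      (Homeomorph.smulOfNeZero r hr.ne').toMeasurableEquiv from rfl, lintegral_map_equiv]
    rfl
  rw [he, h, lintegral_smul_measure, finrank_euclideanSpace_fin, abs_of_nonneg (by positivity),
    smul_eq_mul, ← mul_assoc, ENNReal.rpow_natCast, ← ENNReal.ofReal_pow hr.le,
    ← ENNReal.ofReal_mul (by positivity), mul_inv_cancel₀ (by positivity), ENNReal.ofReal_one,
    one_mul]

theorem integrableOn_norm_rpow_ball (d : ℕ) (hd : 1 ≤ d) {a : ℝ} (ha : -(d : ℝ) < a) :
    IntegrableOn (fun x : EuclideanSpace ℝ (Fin d) => ‖x‖ ^ a) (Metric.ball 0 1) := by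
  have : Nonempty (Fin d) := ⟨⟨0, hd⟩⟩
  rw [integrableOn_fun_norm_addHaar volume (f := fun y => y ^ a), finrank_euclideanSpace_fin]
  have : IntegrableOn (fun y : ℝ => y ^ (d - 1 + a)) (Set.Ioo 0 1) := by
    rw [intervalIntegral.integrableOn_Ioo_rpow_iff one_pos]
    linarith
  refine this.congr_fun (fun y hy => ?_) measurableSet_Ioo
  have hc : ((d - 1 : ℕ) : ℝ) = (d : ℝ) - 1 := by push_cast [hd]; ring
  simp only [smul_eq_mul]
  rw [Real.rpow_add hy.1, ← hc, Real.rpow_natCast]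

theorem integrableOn_norm_rpow_compl_ball (d : ℕ) (hd : 1 ≤ d) {a : ℝ} (ha : a < -(d : ℝ)) :
    IntegrableOn (fun x : EuclideanSpace ℝ (Fin d) => ‖x‖ ^ a) (Metric.ball 0 1)ᶜ := by
  have : Nonempty (Fin d) := ⟨⟨0, hd⟩⟩
  have : Integrable (fun x : EuclideanSpace ℝ (Fin d) =>
      (Set.Ici (1 : ℝ)).indicator (fun y => y ^ a) ‖x‖) := by
    rw [integrable_fun_norm_addHaar volume (f := (Set.Ici (1 : ℝ)).indicator (fun y => y ^ a)),
      finrank_euclideanSpace_fin]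
    have h1 : IntegrableOn (fun y : ℝ => y ^ (d - 1 + a)) (Set.Ici 1) := by
      rw [integrableOn_Ici_iff_integrableOn_Ioi]
      exact integrableOn_Ioi_rpow_of_lt (by linarith) one_pos
    rw [← integrable_indicator_iff measurableSet_Ici] at h1
    refine h1.integrableOn.congr_fun (fun y hy => ?_) measurableSet_Ioi
    have hc : ((d - 1 : ℕ) : ℝ) = (d : ℝ) - 1 := by push_cast [hd]; ring
    by_cases hy1 : y ∈ Set.Ici (1 : ℝ)
    · simp only [smul_eq_mul, Set.indicator_of_mem hy1]
      rw [Real.rpow_add hy, ← hc, Real.rpow_natCast]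
    · simp [Set.indicator_of_notMem hy1]
  rw [← integrable_indicator_iff Metric.isOpen_ball.measurableSet.compl]
  refine this.congr (.of_forall fun x => ?_)
  by_cases hx : 1 ≤ ‖x‖ <;> simp [Set.indicator, hx]

theorem enorm_rpow_ae_eq (d : ℕ) (hd : 1 ≤ d) (a : ℝ) :
    ∀ᵐ x : EuclideanSpace ℝ (Fin d), ‖x‖ₑ ^ a = ‖‖x‖ ^ a‖ₑ := by
  have : Nonempty (Fin d) := ⟨⟨0, hd⟩⟩
  filter_upwards [Measure.ae_ne volume (0 : EuclideanSpace ℝ (Fin d))] with x hx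
  have : 0 < ‖x‖ := norm_pos_iff.2 hx
  rw [Real.enorm_of_nonneg (by positivity), ← ofReal_norm, ENNReal.ofReal_rpow_of_pos this]

theorem lintegral_enorm_rpow_ball_lt_top (d : ℕ) (hd : 1 ≤ d) {a : ℝ} (ha : -(d : ℝ) < a) :
    ∫⁻ x in Metric.ball (0 : EuclideanSpace ℝ (Fin d)) 1, ‖x‖ₑ ^ a < ⊤ := by
  rw [lintegral_congr_ae (ae_restrict_of_ae (enorm_rpow_ae_eq d hd a))]
  exact (integrableOn_norm_rpow_ball d hd ha).2

theorem lintegral_enorm_rpow_compl_ball_lt_top (d : ℕ) (hd : 1 ≤ d) {a : ℝ} (ha : a < -(d : ℝ)) :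
    ∫⁻ x in (Metric.ball (0 : EuclideanSpace ℝ (Fin d)) 1)ᶜ, ‖x‖ₑ ^ a < ⊤ := by
  rw [lintegral_congr_ae (ae_restrict_of_ae (enorm_rpow_ae_eq d hd a))]
  exact (integrableOn_norm_rpow_compl_ball d hd ha).2

theorem lintegral_enorm_rpow_smul (d : ℕ) (a : ℝ) {r : ℝ} (hr : 0 < r)
    {s t : Set (EuclideanSpace ℝ (Fin d))} (hs : MeasurableSet s) (ht : MeasurableSet t)
    (hst : ∀ x, r • x ∈ s ↔ x ∈ t) :
    ∫⁻ x in s, ‖x‖ₑ ^ a = ENNReal.ofReal r ^ (d + a) * ∫⁻ x in t, ‖x‖ₑ ^ a := by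
  have hr0 : ENNReal.ofReal r ≠ 0 := by simpa using hr
  rw [← lintegral_indicator hs, ← lintegral_indicator ht,
    lintegral_eq_mul_lintegral_comp_smul d _ hr, ENNReal.rpow_add _ _ hr0 ofReal_ne_top, mul_assoc]
  congr 1
  rw [← lintegral_const_mul' _ _ (ENNReal.rpow_ne_top_of_ne_zero hr0 ofReal_ne_top)]
  refine lintegral_congr fun x => ?_
  by_cases hx : x ∈ t
  · have hx' := (hst x).2 hx
    simp only [Set.indicator_of_mem hx, Set.indicator_of_mem hx', enorm_smul]
    rw [Real.enorm_of_nonneg hr.le, ENNReal.mul_rpow_of_ne_top ofReal_ne_top enorm_ne_top]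
  · have hx' := mt (hst x).1 hx
    simp [Set.indicator_of_notMem hx, Set.indicator_of_notMem hx']

theorem lintegral_enorm_rpow_ball (d : ℕ) (a : ℝ) {r : ℝ} (hr : 0 < r) :
    ∫⁻ x in Metric.ball (0 : EuclideanSpace ℝ (Fin d)) r, ‖x‖ₑ ^ a =
      ENNReal.ofReal r ^ (d + a) *
        ∫⁻ x in Metric.ball (0 : EuclideanSpace ℝ (Fin d)) 1, ‖x‖ₑ ^ a := by
  refine lintegral_enorm_rpow_smul d a hr measurableSet_ball measurableSet_ball fun x => ?_
  simp [norm_smul, abs_of_pos hr, hr]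

theorem lintegral_enorm_rpow_compl_ball (d : ℕ) (a : ℝ) {r : ℝ} (hr : 0 < r) :
    ∫⁻ x in (Metric.ball (0 : EuclideanSpace ℝ (Fin d)) r)ᶜ, ‖x‖ₑ ^ a =
      ENNReal.ofReal r ^ (d + a) *
        ∫⁻ x in (Metric.ball (0 : EuclideanSpace ℝ (Fin d)) 1)ᶜ, ‖x‖ₑ ^ a := by
  refine lintegral_enorm_rpow_smul d a hr measurableSet_ball.compl measurableSet_ball.compl
    fun x => ?_
  simp [norm_smul, abs_of_pos hr, hr]

/-- The scale at which the low and high frequency bounds of an interpolation balance. -/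
theorem exists_pos_rpow_mul_eq {L A : ℝ≥0∞} (hL0 : L ≠ 0) (hL : L ≠ ⊤) (hA0 : A ≠ 0)
    (hA : A ≠ ⊤) {p : ℝ} (hp : 0 < p) :
    ∃ r : ℝ, 0 < r ∧ A = ENNReal.ofReal r ^ p * L := by
  have h0 : A / L ≠ 0 := (ENNReal.div_pos hA0 hL).ne'
  have h1 : A / L ≠ ⊤ := ENNReal.div_ne_top hA hL0
  have h2 : (A / L) ^ (1 / p) ≠ ⊤ := ENNReal.rpow_ne_top_of_ne_zero h0 h1
  refine ⟨((A / L) ^ (1 / p)).toReal, ENNReal.toReal_pos (by simp [h0, h1, hp]) h2, ?_⟩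
  rw [ENNReal.ofReal_toReal h2, ← ENNReal.rpow_mul, one_div_mul_cancel hp.ne', ENNReal.rpow_one,
    ENNReal.div_mul_cancel hL0 hL]

theorem rpow_one_sub_mul_rpow_scale {L : ℝ≥0∞} (hL0 : L ≠ 0) (hL : L ≠ ⊤) {r : ℝ} (hr : 0 < r)
    (p x : ℝ) :
    L ^ (1 - x) * (ENNReal.ofReal r ^ p * L) ^ x = ENNReal.ofReal r ^ (p * x) * L := by
  have hr0 : ENNReal.ofReal r ≠ 0 := by simpa using hr
  rw [ENNReal.mul_rpow_of_ne_top (ENNReal.rpow_ne_top_of_ne_zero hr0 ofReal_ne_top) hL,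
    ← ENNReal.rpow_mul, mul_left_comm, ← ENNReal.rpow_add _ _ hL0 hL, sub_add_cancel,
    ENNReal.rpow_one]

theorem ae_eq_zero_of_lintegral_weight_eq_zero (d : ℕ) (hd : 1 ≤ d) {α : ℝ}
    {F : EuclideanSpace ℝ (Fin d) → ℝ≥0∞} (hF : Measurable F)
    (h : (∫⁻ ξ, ‖ξ‖ₑ ^ (2 * α) * F ξ ^ (2 : ℝ)) ^ ((1 : ℝ) / 2) = 0) : F =ᵐ[volume] 0 := by
  have : Nonempty (Fin d) := ⟨⟨0, hd⟩⟩
  rw [ENNReal.rpow_eq_zero_iff_of_pos (by norm_num), lintegral_eq_zero_iff (by fun_prop)] at h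
  filter_upwards [h, Measure.ae_ne volume (0 : EuclideanSpace ℝ (Fin d))] with x hx hx0
  have h1 : ‖x‖ₑ ^ (2 * α) ≠ 0 := by
    simp [ENNReal.rpow_eq_zero_iff, hx0]
  simpa [h1] using hx

theorem exists_lintegral_riesz_le (d : ℕ) (hd : 1 ≤ d) {α μ : ℝ} (hμ : 0 < μ)
    (hμα : 2 * μ < d + 2 * α) :
    ∃ C : ℝ≥0∞, C ≠ ⊤ ∧ ∀ (F : EuclideanSpace ℝ (Fin d) → ℝ≥0∞) (L A : ℝ≥0∞), Measurable F →
      (∀ x, F x ≤ L) → L ≠ ⊤ →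
      A = (∫⁻ ξ, ‖ξ‖ₑ ^ (2 * α) * F ξ ^ (2 : ℝ)) ^ ((1 : ℝ) / 2) → A ≠ ⊤ →
      ∫⁻ ξ, ‖ξ‖ₑ ^ (μ - d) * F ξ ≤
        C * (L ^ (1 - 2 * μ / (d + 2 * α)) * A ^ (2 * μ / (d + 2 * α))) := by
  have : Nonempty (Fin d) := ⟨⟨0, hd⟩⟩
  set K1 := ∫⁻ x in Metric.ball (0 : EuclideanSpace ℝ (Fin d)) 1, ‖x‖ₑ ^ (μ - d) with hK1
  set K2 := ∫⁻ x in (Metric.ball (0 : EuclideanSpace ℝ (Fin d)) 1)ᶜ, ‖x‖ₑ ^ (2 * (μ - d - α))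
    with hK2
  have hK1' : K1 < ⊤ := lintegral_enorm_rpow_ball_lt_top d hd (by linarith)
  have hK2' : K2 < ⊤ := lintegral_enorm_rpow_compl_ball_lt_top d hd (by linarith)
  refine ⟨K1 + K2 ^ ((1 : ℝ) / 2), ENNReal.add_ne_top.2
    ⟨hK1'.ne, ENNReal.rpow_ne_top_of_nonneg (by norm_num) hK2'.ne⟩,
    fun F L A hF hFL hL hA hAt => ?_⟩
  by_cases hA0 : A = 0
  · have := ae_eq_zero_of_lintegral_weight_eq_zero d hd hF (hA ▸ hA0)
    have h0 : ∫⁻ ξ, ‖ξ‖ₑ ^ (μ - d) * F ξ = 0 := by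
      rw [lintegral_eq_zero_iff (by fun_prop)]
      filter_upwards [this] with x hx
      simp [hx]
    rw [h0]; exact zero_le
  by_cases hL0 : L = 0
  · have h0 : ∀ x, F x = 0 := fun x => le_antisymm ((hFL x).trans hL0.le) zero_le
    simp [h0]
  have hp : 0 < (d + 2 * α) / 2 := by linarith
  obtain ⟨r, hr, hAr⟩ := exists_pos_rpow_mul_eq hL0 hL hA0 hAt hp
  have hr0 : ENNReal.ofReal r ≠ 0 := by simpa using hr
  have hR : L ^ (1 - 2 * μ / (d + 2 * α)) * A ^ (2 * μ / (d + 2 * α)) =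
      ENNReal.ofReal r ^ μ * L := by
    rw [hAr, rpow_one_sub_mul_rpow_scale hL0 hL hr]
    congr 2
    have : (d : ℝ) + 2 * α ≠ 0 := by linarith
    field_simp
  rw [hR, ← lintegral_add_compl _ (measurableSet_ball (x := (0 : EuclideanSpace ℝ (Fin d)))
    (ε := r)), add_mul]
  refine add_le_add ?_ ?_
  · calc ∫⁻ ξ in Metric.ball 0 r, ‖ξ‖ₑ ^ (μ - d) * F ξ
        ≤ ∫⁻ ξ in Metric.ball (0 : EuclideanSpace ℝ (Fin d)) r, ‖ξ‖ₑ ^ (μ - d) * L :=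
          lintegral_mono fun x => mul_le_mul_right (hFL x) _
      _ = K1 * (ENNReal.ofReal r ^ μ * L) := by
          rw [lintegral_mul_const _ (by fun_prop), lintegral_enorm_rpow_ball d _ hr, ← hK1,
            add_sub_cancel]
          ring
  · calc ∫⁻ ξ in (Metric.ball 0 r)ᶜ, ‖ξ‖ₑ ^ (μ - d) * F ξ
        = ∫⁻ ξ in (Metric.ball 0 r)ᶜ, ‖ξ‖ₑ ^ (μ - d - α) * (‖ξ‖ₑ ^ α * F ξ) := by
          refine lintegral_congr_ae (ae_restrict_of_ae ?_)
          filter_upwards [Measure.ae_ne volume (0 : EuclideanSpace ℝ (Fin d))] with x hx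
          rw [← mul_assoc, ← ENNReal.rpow_add _ _ (by simpa using hx) enorm_ne_top,
            sub_add_cancel]
      _ ≤ (∫⁻ ξ in (Metric.ball 0 r)ᶜ, (‖ξ‖ₑ ^ (μ - d - α)) ^ (2 : ℝ)) ^ ((1 : ℝ) / 2) *
          (∫⁻ ξ in (Metric.ball 0 r)ᶜ, (‖ξ‖ₑ ^ α * F ξ) ^ (2 : ℝ)) ^ ((1 : ℝ) / 2) :=
          ENNReal.lintegral_mul_le_Lp_mul_Lq _ Real.HolderConjugate.two_two
            (by fun_prop) (by fun_prop)
      _ ≤ (∫⁻ ξ in (Metric.ball (0 : EuclideanSpace ℝ (Fin d)) r)ᶜ,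
            ‖ξ‖ₑ ^ (2 * (μ - d - α))) ^ ((1 : ℝ) / 2) * A := by
          refine mul_le_mul' (le_of_eq ?_) ?_
          · congr 1
            refine lintegral_congr fun x => ?_
            rw [← ENNReal.rpow_mul, mul_comm 2]
          · rw [hA]
            refine ENNReal.rpow_le_rpow ((setLIntegral_le_lintegral _ _).trans
              (lintegral_mono fun x => le_of_eq ?_)) (by norm_num)
            rw [ENNReal.mul_rpow_of_nonneg _ _ (by norm_num), ← ENNReal.rpow_mul, mul_comm 2]
      _ = K2 ^ ((1 : ℝ) / 2) * (ENNReal.ofReal r ^ μ * L) := by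
          rw [lintegral_enorm_rpow_compl_ball d _ hr, ← hK2,
            ENNReal.mul_rpow_of_nonneg _ _ (by norm_num), hAr, ← ENNReal.rpow_mul,
            show μ = (d + 2 * (μ - d - α)) * (1 / 2) + (d + 2 * α) / 2 by ring,
            ENNReal.rpow_add _ _ hr0 ofReal_ne_top]
          ring_nf

theorem exists_lintegral_sq_le (d : ℕ) (hd : 1 ≤ d) {α : ℝ} (hα : 0 ≤ α) :
    ∃ C : ℝ≥0∞, C ≠ ⊤ ∧ ∀ (F : EuclideanSpace ℝ (Fin d) → ℝ≥0∞) (L A : ℝ≥0∞), Measurable F →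
      (∀ x, F x ≤ L) → L ≠ ⊤ →
      A = (∫⁻ ξ, ‖ξ‖ₑ ^ (2 * α) * F ξ ^ (2 : ℝ)) ^ ((1 : ℝ) / 2) → A ≠ ⊤ →
      (∫⁻ ξ, F ξ ^ (2 : ℝ)) ^ ((1 : ℝ) / 2) ≤
        C * (L ^ (1 - d / (d + 2 * α)) * A ^ (d / (d + 2 * α))) := by
  have hd' : (1 : ℝ) ≤ d := by exact_mod_cast hd
  have : Nonempty (Fin d) := ⟨⟨0, hd⟩⟩
  set K1 := ∫⁻ x in Metric.ball (0 : EuclideanSpace ℝ (Fin d)) 1, ‖x‖ₑ ^ (0 : ℝ) with hK1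
  have hK1' : K1 < ⊤ := lintegral_enorm_rpow_ball_lt_top d hd (by linarith)
  refine ⟨(K1 + 1) ^ ((1 : ℝ) / 2), ENNReal.rpow_ne_top_of_nonneg (by norm_num)
    (ENNReal.add_ne_top.2 ⟨hK1'.ne, one_ne_top⟩),
    fun F L A hF hFL hL hA hAt => ?_⟩
  by_cases hA0 : A = 0
  · have := ae_eq_zero_of_lintegral_weight_eq_zero d hd hF (hA ▸ hA0)
    have h0 : ∫⁻ ξ, F ξ ^ (2 : ℝ) = 0 := by
      rw [lintegral_eq_zero_iff (by fun_prop)]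
      filter_upwards [this] with x hx
      simp [hx]
    rw [h0]; simp
  by_cases hL0 : L = 0
  · have h0 : ∀ x, F x = 0 := fun x => le_antisymm ((hFL x).trans hL0.le) zero_le
    simp [h0]
  have hp : 0 < (d + 2 * α) / 2 := by linarith
  obtain ⟨r, hr, hAr⟩ := exists_pos_rpow_mul_eq hL0 hL hA0 hAt hp
  have hr0 : ENNReal.ofReal r ≠ 0 := by simpa using hr
  have hR : L ^ (1 - d / (d + 2 * α)) * A ^ (d / (d + 2 * α)) =
      (ENNReal.ofReal r ^ (d : ℝ) * L ^ (2 : ℝ)) ^ ((1 : ℝ) / 2) := by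
    rw [hAr, rpow_one_sub_mul_rpow_scale hL0 hL hr, ENNReal.mul_rpow_of_nonneg _ _ (by norm_num),
      ← ENNReal.rpow_mul, ← ENNReal.rpow_mul]
    have : (d : ℝ) + 2 * α ≠ 0 := by linarith
    rw [show (2 : ℝ) * (1 / 2) = 1 by norm_num, ENNReal.rpow_one]
    congr 2
    field_simp
  have hA2 : A ^ (2 : ℝ) = ∫⁻ ξ, ‖ξ‖ₑ ^ (2 * α) * F ξ ^ (2 : ℝ) := by
    rw [hA, ← ENNReal.rpow_mul]
    norm_num
  rw [hR, ← ENNReal.mul_rpow_of_nonneg _ _ (by norm_num)]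
  refine ENNReal.rpow_le_rpow ?_ (by norm_num)
  rw [← lintegral_add_compl _ (measurableSet_ball (x := (0 : EuclideanSpace ℝ (Fin d)))
    (ε := r)), add_mul]
  refine add_le_add ?_ ?_
  · calc ∫⁻ ξ in Metric.ball 0 r, F ξ ^ (2 : ℝ)
        ≤ ∫⁻ ξ in Metric.ball (0 : EuclideanSpace ℝ (Fin d)) r, ‖ξ‖ₑ ^ (0 : ℝ) * L ^ (2 : ℝ) := by
          refine lintegral_mono fun x => ?_
          rw [ENNReal.rpow_zero, one_mul]
          exact ENNReal.rpow_le_rpow (hFL x) (by norm_num)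
      _ = K1 * (ENNReal.ofReal r ^ (d : ℝ) * L ^ (2 : ℝ)) := by
          rw [lintegral_mul_const _ (by fun_prop), lintegral_enorm_rpow_ball d _ hr, ← hK1,
            add_zero]
          ring
  · calc ∫⁻ ξ in (Metric.ball 0 r)ᶜ, F ξ ^ (2 : ℝ)
        ≤ ∫⁻ ξ in (Metric.ball 0 r)ᶜ,
            ENNReal.ofReal r ^ (-(2 * α)) * (‖ξ‖ₑ ^ (2 * α) * F ξ ^ (2 : ℝ)) := by
          refine setLIntegral_mono' measurableSet_ball.compl fun x hx => ?_
          have hx' : ENNReal.ofReal r ≤ ‖x‖ₑ := by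
            rw [← ofReal_norm]
            exact ENNReal.ofReal_le_ofReal (by simpa using hx)
          rw [← mul_assoc]
          refine le_mul_of_one_le_left zero_le ?_
          calc (1 : ℝ≥0∞) = ENNReal.ofReal r ^ (-(2 * α)) * ENNReal.ofReal r ^ (2 * α) := by
                rw [← ENNReal.rpow_add _ _ hr0 ofReal_ne_top]; simp
            _ ≤ _ := mul_le_mul_right (ENNReal.rpow_le_rpow hx' (by linarith)) _
      _ ≤ ENNReal.ofReal r ^ (-(2 * α)) * A ^ (2 : ℝ) := by
          rw [lintegral_const_mul _ (by fun_prop), hA2]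
          exact mul_le_mul_right (setLIntegral_le_lintegral _ _) _
      _ = 1 * (ENNReal.ofReal r ^ (d : ℝ) * L ^ (2 : ℝ)) := by
          rw [hAr, ENNReal.mul_rpow_of_nonneg _ _ (by norm_num), ← ENNReal.rpow_mul, ← mul_assoc,
            ← ENNReal.rpow_add _ _ hr0 ofReal_ne_top, one_mul]
          ring_nf

theorem memLp_two_of_memLp_two_fourier (d : ℕ) {f : EuclideanSpace ℝ (Fin d) → ℂ}
    (hf : Integrable f) (hF : MemLp (𝓕 f : EuclideanSpace ℝ (Fin d) → ℂ) 2) : MemLp f 2 := by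
  set u : Lp ℂ 2 (volume : Measure (EuclideanSpace ℝ (Fin d))) := 𝓕⁻ (hF.toLp (𝓕 f)) with hu
  have huF : 𝓕 u = hF.toLp (𝓕 f) := fourier_fourierInv_eq _
  have hpair : ∀ φ : SchwartzMap (EuclideanSpace ℝ (Fin d)) ℂ,
      ∫ x, φ x * u x = ∫ x, φ x * f x := by
    intro ψ
    have h := congrArg (fun T => T (𝓕⁻ ψ)) (Lp.fourier_toTemperedDistribution_eq u)
    simp only [TemperedDistribution.fourier_apply, fourier_fourierInv_eq,
      Lp.toTemperedDistribution_apply, smul_eq_mul, huF] at h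
    have h1 : ∫ x, (𝓕⁻ ψ) x * hF.toLp (𝓕 f) x = ∫ x, (𝓕⁻ ψ) x * 𝓕 f x := by
      refine integral_congr_ae ?_
      filter_upwards [hF.coeFn_toLp] with x hx
      rw [hx]
    have h2 := VectorFourier.integral_fourierIntegral_smul_eq_flip
      (L := innerₗ (EuclideanSpace ℝ (Fin d))) (μ := volume) (ν := volume)
      Real.continuous_fourierChar continuous_inner (𝓕⁻ ψ : SchwartzMap (EuclideanSpace ℝ (Fin d)) ℂ).integrable hf
    simp only [smul_eq_mul, flip_innerₗ] at h2
    rw [h, h1]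
    refine h2.symm.trans ?_
    congr 1; ext x
    congr 1
    change 𝓕 (⇑(𝓕⁻ ψ : SchwartzMap (EuclideanSpace ℝ (Fin d)) ℂ)) x = _
    rw [← SchwartzMap.fourier_coe, fourier_fourierInv_eq]
  have hae : ∀ᵐ x, f x - u x = 0 := by
    have hl : LocallyIntegrable (fun x => f x - u x) :=
      hf.locallyIntegrable.sub ((Lp.memLp u).locallyIntegrable one_le_two)
    refine ae_eq_zero_of_integral_contDiff_smul_eq_zero hl fun g hg hc => ?_
    have hg₁ : HasCompactSupport (Complex.ofRealCLM ∘ g) := hc.comp_left rfl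
    have hg₂ : ContDiff ℝ ((⊤ : ℕ∞) : WithTop ℕ∞) (Complex.ofRealCLM ∘ g) := by fun_prop
    have := hpair (hg₁.toSchwartzMap hg₂)
    simp only [HasCompactSupport.toSchwartzMap_toFun, Function.comp,
      Complex.ofRealCLM_apply] at this
    simp only [smul_sub]
    rw [integral_sub (hf.locallyIntegrable.integrable_smul_left_of_hasCompactSupport
        hg.continuous hc)
      (((Lp.memLp u).locallyIntegrable one_le_two).integrable_smul_left_of_hasCompactSupport
        hg.continuous hc)]
    simpa [sub_eq_zero] using this.symm
  refine (Lp.memLp u).ae_eq ?_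
  filter_upwards [hae] with x hx
  exact (sub_eq_zero.1 hx).symm

theorem integrable_of_bounded_mul {X : Type*} [MeasurableSpace X] {μ : Measure X} {f g : X → ℂ}
    (hf : Integrable f μ) (hg : AEStronglyMeasurable g μ) (C : ℝ) (hC : ∀ x, ‖g x‖ ≤ C) :
    Integrable (fun x => g x * f x) μ :=
  hf.bdd_mul hg (.of_forall hC)

theorem enorm_ofReal_of_nonneg {x : ℝ} (hx : 0 ≤ x) : ‖(x : ℂ)‖ₑ = ENNReal.ofReal x := by
  rw [← ofReal_norm, Complex.norm_of_nonneg hx]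

theorem continuous_fourier_of_integrable (d : ℕ) {f : EuclideanSpace ℝ (Fin d) → ℂ}
    (hf : Integrable f) : Continuous (𝓕 f) :=
  VectorFourier.fourierIntegral_continuous Real.continuous_fourierChar continuous_inner hf

theorem enorm_fourier_le (d : ℕ) (f : EuclideanSpace ℝ (Fin d) → ℂ)
    (ξ : EuclideanSpace ℝ (Fin d)) : ‖𝓕 f ξ‖ₑ ≤ ∫⁻ v, ‖f v‖ₑ := by
  rw [Real.fourier_eq']
  refine (enorm_integral_le_lintegral_enorm _).trans (le_of_eq ?_)
  refine lintegral_congr fun v => ?_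
  rw [enorm_smul, ← ofReal_norm, Complex.norm_exp_ofReal_mul_I, ENNReal.ofReal_one, one_mul]

/-- Convolution of an integrable function with a Gaussian, written on the frequency side. -/
theorem integral_gaussian_mul_eq (d : ℕ) {g : EuclideanSpace ℝ (Fin d) → ℂ} (hg : Integrable g)
    {t : ℝ} (ht : 0 < t) (v : EuclideanSpace ℝ (Fin d)) :
    ∫ w, (Real.exp (-(Real.pi * t * ‖v - w‖ ^ 2)) : ℂ) * g w =
      ((t ^ (-(d / 2 : ℝ)) : ℝ) : ℂ) *
        ∫ ζ, Complex.exp (-(Real.pi / t : ℝ) * ‖ζ‖ ^ 2 +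
          2 * Real.pi * Complex.I * inner ℝ v ζ) * 𝓕 g ζ := by
  have hb : 0 < ((Real.pi / t : ℝ) : ℂ).re := by
    rw [Complex.ofReal_re]; positivity
  set φ := fun ζ : EuclideanSpace ℝ (Fin d) =>
    Complex.exp (-(Real.pi / t : ℝ) * ‖ζ‖ ^ 2 + 2 * Real.pi * Complex.I * inner ℝ v ζ) with hφ
  have hint : Integrable φ :=
    GaussianFourier.integrable_cexp_neg_mul_sq_norm_add hb _ v
  have h := VectorFourier.integral_fourierIntegral_smul_eq_flip
      (L := innerₗ (EuclideanSpace ℝ (Fin d))) (μ := volume) (ν := volume)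
      Real.continuous_fourierChar continuous_inner hint hg
  simp only [smul_eq_mul, flip_innerₗ] at h
  have h' := h.symm
  change ∫ ζ, φ ζ * 𝓕 g ζ = ∫ w, 𝓕 φ w * g w at h'
  rw [h', ← integral_const_mul]
  refine integral_congr_ae (.of_forall fun w => ?_)
  simp only
  rw [fourier_gaussian_innerProductSpace' hb, ← mul_assoc, ← mul_assoc]
  congr 1
  have hpi := Real.pi_ne_zero
  have e1 : (Real.pi / ((Real.pi / t : ℝ) : ℂ)) = (t : ℂ) := by
    push_cast
    have : (Real.pi : ℂ) ≠ 0 := by exact_mod_cast hpi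
    have : (t : ℂ) ≠ 0 := by exact_mod_cast ht.ne'
    field_simp
  rw [e1, finrank_euclideanSpace_fin]
  have e2 : ((t : ℂ) ^ ((d : ℂ) / 2)) = ((t ^ (d / 2 : ℝ) : ℝ) : ℂ) := by
    rw [Complex.ofReal_cpow ht.le]; push_cast; rfl
  rw [e2, ← Complex.ofReal_mul, ← Real.rpow_add ht, neg_add_cancel, Real.rpow_zero,
    Complex.ofReal_one, one_mul]
  push_cast
  congr 1
  have : (Real.pi : ℂ) ≠ 0 := by exact_mod_cast hpi
  have : (t : ℂ) ≠ 0 := by exact_mod_cast ht.ne'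
  field_simp

theorem enorm_integral_fourier_gaussian_le (d : ℕ) {f g : EuclideanSpace ℝ (Fin d) → ℂ}
    (hf : Integrable f) (hg : Integrable g) {t : ℝ} (ht : 0 < t)
    (ξ : EuclideanSpace ℝ (Fin d)) :
    ‖∫ v, Complex.exp ((-2 * Real.pi * inner ℝ v ξ : ℝ) * Complex.I) * f v *
        ∫ w, (Real.exp (-(Real.pi * t * ‖v - w‖ ^ 2)) : ℂ) * g w‖ₑ ≤
      ∫⁻ ζ, ENNReal.ofReal (t ^ (-(d / 2 : ℝ)) * Real.exp (-(Real.pi / t * ‖ζ‖ ^ 2))) *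
        (‖𝓕 f (ξ - ζ)‖ₑ * ‖𝓕 g ζ‖ₑ) := by
  have hcg := continuous_fourier_of_integrable d hg
  have hb : 0 < ((Real.pi / t : ℝ) : ℂ).re := by
    rw [Complex.ofReal_re]; positivity
  have hgauss : Integrable fun ζ : EuclideanSpace ℝ (Fin d) =>
      Complex.exp (-(Real.pi / t : ℝ) * ‖ζ‖ ^ 2) := by
    simpa using GaussianFourier.integrable_cexp_neg_mul_sq_norm_add hb 0
      (0 : EuclideanSpace ℝ (Fin d))
  have hgauss' : Integrable fun ζ : EuclideanSpace ℝ (Fin d) =>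
      𝓕 g ζ * Complex.exp (-(Real.pi / t : ℝ) * ‖ζ‖ ^ 2) := by
    refine integrable_of_bounded_mul hgauss hcg.aestronglyMeasurable (∫ v, ‖g v‖) fun x => ?_
    exact VectorFourier.norm_fourierIntegral_le_integral_norm _ _ _ _ _
  have hprod : Integrable (fun p : EuclideanSpace ℝ (Fin d) × EuclideanSpace ℝ (Fin d) =>
      Complex.exp ((-2 * Real.pi * inner ℝ p.1 (ξ - p.2) : ℝ) * Complex.I) *
        (f p.1 * (𝓕 g p.2 * Complex.exp (-(Real.pi / t : ℝ) * ‖p.2‖ ^ 2))))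
      (volume.prod volume) := by
    refine integrable_of_bounded_mul (hf.mul_prod hgauss') ?_ 1 fun x =>
      (Complex.norm_exp_ofReal_mul_I _).le
    refine Continuous.aestronglyMeasurable ?_
    fun_prop
  have key : ∀ v, Complex.exp ((-2 * Real.pi * inner ℝ v ξ : ℝ) * Complex.I) * f v *
        ∫ w, (Real.exp (-(Real.pi * t * ‖v - w‖ ^ 2)) : ℂ) * g w =
      ((t ^ (-(d / 2 : ℝ)) : ℝ) : ℂ) * ∫ ζ, Complex.exp ((-2 * Real.pi * inner ℝ v (ξ - ζ) : ℝ) * Complex.I) *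
        (f v * (𝓕 g ζ * Complex.exp (-(Real.pi / t : ℝ) * ‖ζ‖ ^ 2))) := by
    intro v
    rw [integral_gaussian_mul_eq d hg ht, mul_left_comm, ← integral_const_mul]
    congr 1
    refine integral_congr_ae (.of_forall fun ζ => ?_)
    simp only
    rw [inner_sub_right, show ((-2 * Real.pi * (inner ℝ v ξ - inner ℝ v ζ) : ℝ) : ℂ) * Complex.I =
      (-2 * Real.pi * inner ℝ v ξ : ℝ) * Complex.I + 2 * Real.pi * Complex.I * inner ℝ v ζ by
        push_cast; ring, Complex.exp_add, Complex.exp_add]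
    ring
  simp_rw [key]
  rw [integral_const_mul, integral_integral_swap hprod, ← integral_const_mul]
  refine (enorm_integral_le_lintegral_enorm _).trans (le_of_eq (lintegral_congr fun ζ => ?_))
  have e1 : ∫ v : EuclideanSpace ℝ (Fin d), Complex.exp ((-2 * Real.pi * inner ℝ v (ξ - ζ) : ℝ) * Complex.I) *
        (f v * (𝓕 g ζ * Complex.exp (-(Real.pi / t : ℝ) * ‖ζ‖ ^ 2))) =
      𝓕 f (ξ - ζ) * (𝓕 g ζ * Complex.exp (-(Real.pi / t : ℝ) * ‖ζ‖ ^ 2)) := by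
    generalize 𝓕 g ζ * Complex.exp (-(Real.pi / t : ℝ) * ‖ζ‖ ^ 2) = z
    rw [Real.fourier_eq', ← integral_mul_const]
    refine integral_congr_ae (.of_forall fun v => ?_)
    simp only [smul_eq_mul]
    ring
  rw [e1, show Complex.exp (-(Real.pi / t : ℝ) * ‖ζ‖ ^ 2) =
    ((Real.exp (-(Real.pi / t * ‖ζ‖ ^ 2)) : ℝ) : ℂ) by push_cast; ring_nf]
  rw [enorm_mul, enorm_mul, enorm_mul, enorm_ofReal_of_nonneg (by positivity),
    enorm_ofReal_of_nonneg (by positivity), ENNReal.ofReal_mul (by positivity)]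
  ring

theorem exists_lintegral_conv_riesz_le (d : ℕ) (hd : 1 ≤ d) {lam : ℝ} (h0 : 0 < lam)
    (hlam : lam < d / 2) {g : EuclideanSpace ℝ (Fin d) → ℂ} (hg : Integrable g)
    (hg2 : MemLp g 2) :
    ∃ M : ℝ≥0∞, M ≠ ⊤ ∧ ∀ v, ∫⁻ w, ‖v - w‖ₑ ^ (-lam) * ‖g w‖ₑ ≤ M := by
  have hK := lintegral_enorm_rpow_ball_lt_top d hd (a := -lam * 2) (by linarith)
  have hg2' : ∫⁻ w, ‖g w‖ₑ ^ (2 : ℝ) < ⊤ := by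
    have := hg2.2
    rw [eLpNorm_lt_top_iff_lintegral_rpow_enorm_lt_top (by simp) (by simp)] at this
    simpa using this
  refine ⟨(∫⁻ x in Metric.ball (0 : EuclideanSpace ℝ (Fin d)) 1, ‖x‖ₑ ^ (-lam * 2)) ^ (1 / 2 : ℝ) *
    (∫⁻ w, ‖g w‖ₑ ^ (2 : ℝ)) ^ (1 / 2 : ℝ) + ∫⁻ w, ‖g w‖ₑ, ENNReal.add_ne_top.2
    ⟨ENNReal.mul_ne_top (ENNReal.rpow_ne_top_of_nonneg (by norm_num) hK.ne)
      (ENNReal.rpow_ne_top_of_nonneg (by norm_num) hg2'.ne), hg.2.ne⟩, fun v => ?_⟩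
  have hmeas : AEMeasurable (fun w => ‖g w‖ₑ) := hg.1.enorm
  rw [← lintegral_add_compl _ (measurableSet_ball (x := v) (ε := 1))]
  refine add_le_add ?_ ?_
  · refine (ENNReal.lintegral_mul_le_Lp_mul_Lq _ Real.HolderConjugate.two_two
      (by fun_prop) hmeas.restrict).trans (mul_le_mul' (le_of_eq ?_) ?_)
    · congr 1
      rw [← lintegral_indicator measurableSet_ball, ← lintegral_indicator measurableSet_ball,
        ← lintegral_sub_left_eq_self _ v]
      refine lintegral_congr fun w => ?_
      simp only [ENNReal.rpow_mul]
      by_cases hw : ‖w‖ < 1 <;> simp [Set.indicator, hw, dist_eq_norm]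
    · exact ENNReal.rpow_le_rpow (setLIntegral_le_lintegral _ _) (by norm_num)
  · refine (setLIntegral_mono' measurableSet_ball.compl (g := fun w => ‖g w‖ₑ)
      fun w hw => ?_).trans (setLIntegral_le_lintegral _ _)
    refine mul_le_of_le_one_left zero_le ?_
    rw [ENNReal.rpow_neg]
    refine ENNReal.inv_le_one.2 (ENNReal.one_le_rpow ?_ h0)
    rw [← ofReal_norm, ENNReal.one_le_ofReal]
    simpa [dist_eq_norm, norm_sub_rev] using hw

theorem integral_rpow_mul_exp_sq {a ρ : ℝ} (ha : 0 < a) (hρ : 0 < ρ) :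
    ∫ t in Set.Ioi (0 : ℝ), t ^ (a - 1) * Real.exp (-(Real.pi * t * ρ ^ 2)) =
      Real.pi ^ (-a) * Real.Gamma a * ρ ^ (-(2 * a)) := by
  have hpi := Real.pi_pos
  have h := Real.integral_rpow_mul_exp_neg_mul_Ioi ha (r := Real.pi * ρ ^ 2) (by positivity)
  simp only [show ∀ t, Real.pi * t * ρ ^ 2 = Real.pi * ρ ^ 2 * t from fun t => by ring]
  rw [h, one_div, Real.inv_rpow (by positivity), ← Real.rpow_neg (by positivity),
    Real.mul_rpow hpi.le (by positivity), ← Real.rpow_natCast ρ 2, ← Real.rpow_mul hρ.le]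
  push_cast
  ring_nf

theorem integrableOn_rpow_mul_exp_sq {a ρ : ℝ} (ha : 0 < a) (hρ : 0 < ρ) :
    IntegrableOn (fun t : ℝ => t ^ (a - 1) * Real.exp (-(Real.pi * t * ρ ^ 2)))
      (Set.Ioi 0) := by
  refine Integrable.of_integral_ne_zero ?_
  rw [integral_rpow_mul_exp_sq ha hρ]
  have := Real.Gamma_pos_of_pos ha
  have := Real.pi_pos
  positivity

theorem lintegral_rpow_mul_exp_sq (d : ℕ) {a : ℝ} (ha : 0 < a) {x : EuclideanSpace ℝ (Fin d)}
    (hx : x ≠ 0) :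
    ∫⁻ t in Set.Ioi (0 : ℝ), ENNReal.ofReal (t ^ (a - 1) * Real.exp (-(Real.pi * t * ‖x‖ ^ 2))) =
      ENNReal.ofReal (Real.pi ^ (-a) * Real.Gamma a) * ‖x‖ₑ ^ (-(2 * a)) := by
  have hx' : 0 < ‖x‖ := norm_pos_iff.2 hx
  have := Real.Gamma_pos_of_pos ha
  have := Real.pi_pos
  rw [← ofReal_integral_eq_lintegral_ofReal (integrableOn_rpow_mul_exp_sq ha hx'),
    integral_rpow_mul_exp_sq ha hx', ENNReal.ofReal_mul (by positivity),
    ← ENNReal.ofReal_rpow_of_pos hx', ofReal_norm]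
  filter_upwards [ae_restrict_mem measurableSet_Ioi] with t ht
  have : 0 < t := ht
  simp only [Pi.zero_apply]
  positivity

theorem lintegral_rpow_mul_exp_inv_sq (d : ℕ) {a : ℝ} (ha : 0 < a)
    {x : EuclideanSpace ℝ (Fin d)} (hx : x ≠ 0) :
    ∫⁻ t in Set.Ioi (0 : ℝ), ENNReal.ofReal (t ^ (-a - 1) * Real.exp (-(Real.pi / t * ‖x‖ ^ 2))) =
      ENNReal.ofReal (Real.pi ^ (-a) * Real.Gamma a) * ‖x‖ₑ ^ (-(2 * a)) := by
  have hx' : 0 < ‖x‖ := norm_pos_iff.2 hx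
  have := Real.Gamma_pos_of_pos ha
  have := Real.pi_pos
  set G : ℝ → ℝ := fun t => t ^ (a - 1) * Real.exp (-(Real.pi * t * ‖x‖ ^ 2)) with hG
  have heq : Set.EqOn (fun t : ℝ => (|(-1 : ℝ)| * t ^ ((-1 : ℝ) - 1)) • G (t ^ (-1 : ℝ)))
      (fun t => t ^ (-a - 1) * Real.exp (-(Real.pi / t * ‖x‖ ^ 2))) (Set.Ioi 0) := by
    intro t ht
    have ht' : (0 : ℝ) < t := ht
    simp only [hG, smul_eq_mul, abs_neg, abs_one, one_mul]
    rw [← Real.rpow_mul ht'.le, ← mul_assoc, ← Real.rpow_add ht', Real.rpow_neg_one,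
      div_eq_mul_inv]
    ring_nf
  have hI := integral_comp_rpow_Ioi G (p := -1) (by norm_num)
  rw [setIntegral_congr_fun measurableSet_Ioi heq, integral_rpow_mul_exp_sq ha hx'] at hI
  have hint : IntegrableOn (fun t : ℝ => t ^ (-a - 1) * Real.exp (-(Real.pi / t * ‖x‖ ^ 2)))
      (Set.Ioi 0) := by
    refine Integrable.of_integral_ne_zero ?_
    rw [hI]
    positivity
  rw [← ofReal_integral_eq_lintegral_ofReal hint, hI, ENNReal.ofReal_mul (by positivity),
    ← ENNReal.ofReal_rpow_of_pos hx', ofReal_norm]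
  filter_upwards [ae_restrict_mem measurableSet_Ioi] with t ht
  have : 0 < t := ht
  simp only [Pi.zero_apply]
  positivity

theorem lintegral_rpow_mul_exp_sq_le (d : ℕ) {a : ℝ} (ha : 0 < a)
    (x : EuclideanSpace ℝ (Fin d)) :
    ∫⁻ t in Set.Ioi (0 : ℝ), ENNReal.ofReal (t ^ (a - 1) * Real.exp (-(Real.pi * t * ‖x‖ ^ 2))) ≤
      ENNReal.ofReal (Real.pi ^ (-a) * Real.Gamma a) * ‖x‖ₑ ^ (-(2 * a)) := by
  by_cases hx : x = 0
  · have := Real.Gamma_pos_of_pos ha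
    have := Real.pi_pos
    have hpos : ENNReal.ofReal (Real.pi ^ (-a) * Real.Gamma a) ≠ 0 := by
      rw [Ne, ENNReal.ofReal_eq_zero, not_le]
      positivity
    rw [hx, enorm_zero, ENNReal.zero_rpow_of_neg (by linarith), ENNReal.mul_top hpos]
    exact le_top
  · exact (lintegral_rpow_mul_exp_sq d ha hx).le

/-- The integrand obtained by writing the Riesz kernel as a superposition of Gaussians. -/
noncomputable def gaussianIntegrand (d : ℕ) (lam : ℝ) (f g : EuclideanSpace ℝ (Fin d) → ℂ)
    (ξ : EuclideanSpace ℝ (Fin d))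
    (q : (EuclideanSpace ℝ (Fin d) × EuclideanSpace ℝ (Fin d)) × ℝ) : ℂ :=
  Complex.exp ((-2 * Real.pi * inner ℝ q.1.1 ξ : ℝ) * Complex.I) * (f q.1.1 * g q.1.2) *
    ((q.2 ^ (lam / 2 - 1) * Real.exp (-(Real.pi * q.2 * ‖q.1.1 - q.1.2‖ ^ 2)) : ℝ) : ℂ)

theorem integrable_gaussianIntegrand (d : ℕ) {lam : ℝ} (h0 : 0 < lam)
    {f g : EuclideanSpace ℝ (Fin d) → ℂ} (hf : Integrable f) (hg : Integrable g)
    {M : ℝ≥0∞} (hM : M ≠ ⊤) (hMv : ∀ v, ∫⁻ w, ‖v - w‖ₑ ^ (-lam) * ‖g w‖ₑ ≤ M)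
    (ξ : EuclideanSpace ℝ (Fin d)) :
    Integrable (gaussianIntegrand d lam f g ξ)
      ((volume.prod volume).prod (volume.restrict (Set.Ioi 0))) := by
  have hfg : AEStronglyMeasurable (fun q : EuclideanSpace ℝ (Fin d) × EuclideanSpace ℝ (Fin d) =>
      f q.1 * g q.2) (volume.prod volume) := (hf.mul_prod hg).1
  have hmeas : AEStronglyMeasurable (gaussianIntegrand d lam f g ξ)
      ((volume.prod volume).prod (volume.restrict (Set.Ioi 0))) := by
    refine AEStronglyMeasurable.mul (AEStronglyMeasurable.mul ?_ ?_) ?_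
    · exact Continuous.aestronglyMeasurable (by fun_prop)
    · exact hfg.comp_fst
    · exact Measurable.aestronglyMeasurable (by fun_prop)
  refine ⟨hmeas, ?_⟩
  rw [HasFiniteIntegral, lintegral_prod _ hmeas.enorm]
  set κ := ENNReal.ofReal (Real.pi ^ (-(lam / 2)) * Real.Gamma (lam / 2)) with hκ
  calc ∫⁻ p, (∫⁻ t in Set.Ioi (0 : ℝ), ‖gaussianIntegrand d lam f g ξ (p, t)‖ₑ) ∂(volume.prod volume)
      ≤ ∫⁻ p : EuclideanSpace ℝ (Fin d) × EuclideanSpace ℝ (Fin d),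
          ‖f p.1 * g p.2‖ₑ * (κ * ‖p.1 - p.2‖ₑ ^ (-lam)) ∂(volume.prod volume) := by
        refine lintegral_mono fun p => ?_
        calc ∫⁻ t in Set.Ioi 0, ‖gaussianIntegrand d lam f g ξ (p, t)‖ₑ
            = ∫⁻ t in Set.Ioi (0 : ℝ), ‖f p.1 * g p.2‖ₑ * ENNReal.ofReal
                (t ^ (lam / 2 - 1) * Real.exp (-(Real.pi * t * ‖p.1 - p.2‖ ^ 2))) := by
              refine setLIntegral_congr_fun measurableSet_Ioi fun t ht => ?_
              have ht' : (0 : ℝ) < t := ht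
              simp only [gaussianIntegrand]
              rw [enorm_mul, enorm_mul, enorm_ofReal_of_nonneg (by positivity), ← ofReal_norm,
                Complex.norm_exp_ofReal_mul_I, ENNReal.ofReal_one, one_mul]
          _ ≤ _ := by
              rw [lintegral_const_mul' _ _ enorm_ne_top]
              refine mul_le_mul_right ?_ _
              refine (lintegral_rpow_mul_exp_sq_le d (half_pos h0) (p.1 - p.2)).trans ?_
              rw [mul_div_cancel₀ lam two_ne_zero]
    _ = ∫⁻ v, ∫⁻ w, ‖f v * g w‖ₑ * (κ * ‖v - w‖ₑ ^ (-lam)) := by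
        rw [lintegral_prod]
        exact hfg.enorm.mul (Measurable.aemeasurable (by fun_prop))
    _ = ∫⁻ v, ‖f v‖ₑ * κ * ∫⁻ w, ‖v - w‖ₑ ^ (-lam) * ‖g w‖ₑ := by
        refine lintegral_congr fun v => ?_
        rw [← lintegral_const_mul' _ _ (ENNReal.mul_ne_top enorm_ne_top ofReal_ne_top)]
        refine lintegral_congr fun w => ?_
        rw [enorm_mul]
        ring
    _ ≤ ∫⁻ v, ‖f v‖ₑ * (κ * M) := by
        refine lintegral_mono fun v => ?_
        rw [mul_assoc]
        exact mul_le_mul_right (mul_le_mul_right (hMv v) _) _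
    _ < ⊤ := by
        rw [lintegral_mul_const' _ _ (ENNReal.mul_ne_top ofReal_ne_top hM)]
        exact ENNReal.mul_lt_top hf.2 (ENNReal.mul_ne_top ofReal_ne_top hM).lt_top

theorem fourier_Qminus_eq (d : ℕ) (hd : 1 ≤ d) (c : ℝ) {lam : ℝ} (h0 : 0 < lam)
    {f g : EuclideanSpace ℝ (Fin d) → ℂ} (hf : Integrable f) (hg : Integrable g)
    {M : ℝ≥0∞} (hM : M ≠ ⊤) (hMv : ∀ v, ∫⁻ w, ‖v - w‖ₑ ^ (-lam) * ‖g w‖ₑ ≤ M)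
    (ξ : EuclideanSpace ℝ (Fin d)) :
    ((Real.pi ^ (-(lam / 2)) * Real.Gamma (lam / 2) : ℝ) : ℂ) * 𝓕 (Qminus d c lam f g) ξ =
      c * ∫ t in Set.Ioi (0 : ℝ), ((t ^ (lam / 2 - 1) : ℝ) : ℂ) *
        ∫ v, Complex.exp ((-2 * Real.pi * inner ℝ v ξ : ℝ) * Complex.I) * f v *
          ∫ w, (Real.exp (-(Real.pi * t * ‖v - w‖ ^ 2)) : ℂ) * g w := by
  have : Nonempty (Fin d) := ⟨⟨0, hd⟩⟩
  have hK := integrable_gaussianIntegrand d h0 hf hg hM hMv ξ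
  have hR : ∫ t in Set.Ioi (0 : ℝ), ∫ p, gaussianIntegrand d lam f g ξ (p, t)
        ∂(volume.prod volume) =
      ∫ t in Set.Ioi (0 : ℝ), ((t ^ (lam / 2 - 1) : ℝ) : ℂ) *
        ∫ v, Complex.exp ((-2 * Real.pi * inner ℝ v ξ : ℝ) * Complex.I) * f v *
          ∫ w, (Real.exp (-(Real.pi * t * ‖v - w‖ ^ 2)) : ℂ) * g w := by
    refine integral_congr_ae ?_
    filter_upwards [hK.prod_left_ae] with t ht
    rw [integral_prod _ ht, ← integral_const_mul]
    refine integral_congr_ae (.of_forall fun v => ?_)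
    simp only
    rw [← integral_const_mul, ← integral_const_mul]
    refine integral_congr_ae (.of_forall fun w => ?_)
    simp only [gaussianIntegrand]
    push_cast
    ring
  rw [← hR, ← integral_integral_swap (f := fun p t => gaussianIntegrand d lam f g ξ (p, t)) hK,
    integral_prod _ hK.integral_prod_left, Real.fourier_eq', ← integral_const_mul,
    ← integral_const_mul]
  refine integral_congr_ae (.of_forall fun v => ?_)
  simp only [Qminus, smul_eq_mul]
  rw [← integral_const_mul, ← integral_const_mul, ← integral_const_mul, ← integral_const_mul]
  refine integral_congr_ae ?_
  filter_upwards [Measure.ae_ne volume v] with w hw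
  have hvw : 0 < ‖v - w‖ := norm_pos_iff.2 (sub_ne_zero.2 hw.symm)
  simp only [gaussianIntegrand]
  rw [integral_const_mul, integral_complex_ofReal, integral_rpow_mul_exp_sq (half_pos h0) hvw,
    mul_div_cancel₀ lam two_ne_zero]
  push_cast
  ring

theorem exists_enorm_fourier_Qminus_le (d : ℕ) (hd : 1 ≤ d) {lam : ℝ} (h0 : 0 < lam)
    (hlam : lam < d / 2) :
    ∃ C : ℝ≥0∞, C ≠ ⊤ ∧ ∀ (c : ℝ) (f g : EuclideanSpace ℝ (Fin d) → ℂ), 0 ≤ c → Integrable f →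
      Integrable g → MemLp g 2 → ∀ ξ, ‖𝓕 (Qminus d c lam f g) ξ‖ₑ ≤
        C * ENNReal.ofReal c * ∫⁻ ζ, ‖ζ‖ₑ ^ (lam - d) * (‖𝓕 f (ξ - ζ)‖ₑ * ‖𝓕 g ζ‖ₑ) := by
  have : Nonempty (Fin d) := ⟨⟨0, hd⟩⟩
  have hG := Real.Gamma_pos_of_pos (half_pos h0)
  have hpi := Real.pi_pos
  have hκ : 0 < Real.pi ^ (-(lam / 2)) * Real.Gamma (lam / 2) := by positivity
  set κ := Real.pi ^ (-(lam / 2)) * Real.Gamma (lam / 2)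
  set a : ℝ := (d - lam) / 2 with ha
  have ha0 : 0 < a := by rw [ha]; linarith
  set κ' := ENNReal.ofReal (Real.pi ^ (-a) * Real.Gamma a)
  have hκ0 : ENNReal.ofReal κ ≠ 0 := by simpa using hκ
  refine ⟨(ENNReal.ofReal κ)⁻¹ * κ', ENNReal.mul_ne_top (ENNReal.inv_ne_top.2 hκ0) ofReal_ne_top,
    fun c f g hc hf hg hg2 ξ => ?_⟩
  obtain ⟨M, hM, hMv⟩ := exists_lintegral_conv_riesz_le d hd h0 hlam hg hg2
  have hcf := continuous_fourier_of_integrable d hf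
  have hcg := continuous_fourier_of_integrable d hg
  have hmain : ENNReal.ofReal κ * ‖𝓕 (Qminus d c lam f g) ξ‖ₑ ≤ ENNReal.ofReal c *
      (κ' * ∫⁻ ζ, ‖ζ‖ₑ ^ (lam - d) * (‖𝓕 f (ξ - ζ)‖ₑ * ‖𝓕 g ζ‖ₑ)) := by
    rw [← enorm_ofReal_of_nonneg hκ.le, ← enorm_mul, fourier_Qminus_eq d hd c h0 hf hg hM hMv,
      enorm_mul, enorm_ofReal_of_nonneg hc]
    refine mul_le_mul_right ((enorm_integral_le_lintegral_enorm _).trans ?_) _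
    calc _ ≤ ∫⁻ t in Set.Ioi (0 : ℝ), ∫⁻ ζ, ENNReal.ofReal
              (t ^ (-a - 1) * Real.exp (-(Real.pi / t * ‖ζ‖ ^ 2))) *
            (‖𝓕 f (ξ - ζ)‖ₑ * ‖𝓕 g ζ‖ₑ) := by
          refine setLIntegral_mono' measurableSet_Ioi fun t ht => ?_
          have ht' : (0 : ℝ) < t := ht
          rw [enorm_mul, enorm_ofReal_of_nonneg (by positivity)]
          refine (mul_le_mul_right (enorm_integral_fourier_gaussian_le d hf hg ht' ξ) _).trans ?_
          rw [← lintegral_const_mul' _ _ ofReal_ne_top]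
          refine lintegral_mono fun ζ => le_of_eq ?_
          rw [← mul_assoc, ← ENNReal.ofReal_mul (by positivity), ← mul_assoc (t ^ (lam / 2 - 1)),
            ← Real.rpow_add ht', show lam / 2 - 1 + -(d / 2 : ℝ) = -a - 1 by rw [ha]; ring]
      _ = ∫⁻ ζ, ∫⁻ t in Set.Ioi (0 : ℝ), ENNReal.ofReal
              (t ^ (-a - 1) * Real.exp (-(Real.pi / t * ‖ζ‖ ^ 2))) *
            (‖𝓕 f (ξ - ζ)‖ₑ * ‖𝓕 g ζ‖ₑ) := by
          refine lintegral_lintegral_swap (Measurable.aemeasurable ?_)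
          have := hcf.measurable
          have := hcg.measurable
          simp only [Function.uncurry_def]
          fun_prop
      _ = ∫⁻ ζ, κ' * (‖ζ‖ₑ ^ (lam - d) * (‖𝓕 f (ξ - ζ)‖ₑ * ‖𝓕 g ζ‖ₑ)) := by
          refine lintegral_congr_ae ?_
          filter_upwards [Measure.ae_ne volume (0 : EuclideanSpace ℝ (Fin d))] with ζ hζ
          rw [lintegral_mul_const' _ _ (ENNReal.mul_ne_top enorm_ne_top enorm_ne_top),
            lintegral_rpow_mul_exp_inv_sq d ha0 hζ, mul_assoc,
            show -(2 * a) = lam - d by rw [ha]; ring]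
      _ = _ := by rw [lintegral_const_mul' _ _ ofReal_ne_top]
  calc ‖𝓕 (Qminus d c lam f g) ξ‖ₑ
      = (ENNReal.ofReal κ)⁻¹ * (ENNReal.ofReal κ * ‖𝓕 (Qminus d c lam f g) ξ‖ₑ) := by
        rw [← mul_assoc, ENNReal.inv_mul_cancel hκ0 ofReal_ne_top, one_mul]
    _ ≤ _ := mul_le_mul_right hmain _
    _ = _ := by ring

/-- Young's convolution inequality `L² * L¹ ⊆ L²` for nonnegative functions. -/
theorem lintegral_conv_sq_le (d : ℕ) {P W : EuclideanSpace ℝ (Fin d) → ℝ≥0∞}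
    (hP : Measurable P) (hW : Measurable W) :
    (∫⁻ ξ, (∫⁻ ζ, P (ξ - ζ) * W ζ) ^ (2 : ℝ)) ^ ((1 : ℝ) / 2) ≤
      (∫⁻ ξ, P ξ ^ (2 : ℝ)) ^ ((1 : ℝ) / 2) * ∫⁻ ζ, W ζ := by
  have hhalf : (0 : ℝ) ≤ 1 / 2 := by norm_num
  have hpt : ∀ ξ, (∫⁻ ζ, P (ξ - ζ) * W ζ) ^ (2 : ℝ) ≤
      (∫⁻ ζ, P (ξ - ζ) ^ (2 : ℝ) * W ζ) * ∫⁻ ζ, W ζ := by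
    intro ξ
    have hs : ∀ x : ℝ≥0∞, x ^ (1 / 2 : ℝ) * x ^ (1 / 2 : ℝ) = x := fun x => by
      rw [← ENNReal.rpow_add_of_nonneg _ _ hhalf hhalf]; norm_num
    have h := ENNReal.lintegral_mul_le_Lp_mul_Lq volume Real.HolderConjugate.two_two
      (f := fun ζ => P (ξ - ζ) * W ζ ^ (1 / 2 : ℝ)) (g := fun ζ => W ζ ^ (1 / 2 : ℝ))
      (by fun_prop) (by fun_prop)
    have h' := ENNReal.rpow_le_rpow h zero_le_two
    rw [ENNReal.mul_rpow_of_nonneg _ _ zero_le_two, ← ENNReal.rpow_mul, ← ENNReal.rpow_mul,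
      one_div_mul_cancel two_ne_zero, ENNReal.rpow_one, ENNReal.rpow_one] at h'
    refine le_trans (le_of_eq ?_) (h'.trans (le_of_eq ?_))
    · congr 1
      refine lintegral_congr fun ζ => ?_
      simp only [Pi.mul_apply]
      rw [mul_assoc, hs]
    · congr 1
      · refine lintegral_congr fun ζ => ?_
        rw [ENNReal.mul_rpow_of_nonneg _ _ zero_le_two, ← ENNReal.rpow_mul,
          one_div_mul_cancel two_ne_zero, ENNReal.rpow_one]
      · refine lintegral_congr fun ζ => ?_
        rw [← ENNReal.rpow_mul, one_div_mul_cancel two_ne_zero, ENNReal.rpow_one]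
  have hmain : ∫⁻ ξ, (∫⁻ ζ, P (ξ - ζ) * W ζ) ^ (2 : ℝ) ≤
      (∫⁻ ξ, P ξ ^ (2 : ℝ)) * (∫⁻ ζ, W ζ) ^ (2 : ℝ) := by
    calc _ ≤ ∫⁻ ξ, (∫⁻ ζ, P (ξ - ζ) ^ (2 : ℝ) * W ζ) * ∫⁻ ζ, W ζ := lintegral_mono hpt
      _ = (∫⁻ ξ, ∫⁻ ζ, P (ξ - ζ) ^ (2 : ℝ) * W ζ) * ∫⁻ ζ, W ζ := by
          rw [lintegral_mul_const]
          exact Measurable.lintegral_prod_right' (f := fun p => P (p.1 - p.2) ^ (2 : ℝ) * W p.2)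
            (by fun_prop)
      _ = (∫⁻ ζ, ∫⁻ ξ, P (ξ - ζ) ^ (2 : ℝ) * W ζ) * ∫⁻ ζ, W ζ := by
          rw [lintegral_lintegral_swap]
          simp only [Function.uncurry_def]
          fun_prop
      _ = (∫⁻ ζ, (∫⁻ ξ, P ξ ^ (2 : ℝ)) * W ζ) * ∫⁻ ζ, W ζ := by
          congr 1
          refine lintegral_congr fun ζ => ?_
          rw [lintegral_mul_const _ (by fun_prop),
            lintegral_sub_right_eq_self (fun x => P x ^ (2 : ℝ))]
      _ = _ := by
          rw [lintegral_const_mul _ hW, mul_assoc, ENNReal.rpow_two, sq]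
  refine (ENNReal.rpow_le_rpow hmain hhalf).trans (le_of_eq ?_)
  rw [ENNReal.mul_rpow_of_nonneg _ _ hhalf, ← ENNReal.rpow_mul (∫⁻ ζ, W ζ),
    mul_one_div_cancel two_ne_zero, ENNReal.rpow_one]

theorem add_rpow_le_two_rpow_mul (x y : ℝ≥0∞) {α : ℝ} (hα : 0 ≤ α) :
    (x + y) ^ α ≤ 2 ^ α * (x ^ α + y ^ α) := by
  have hmax : (x + y) ^ α ≤ (2 * max x y) ^ α := by
    refine ENNReal.rpow_le_rpow ?_ hα
    rw [two_mul]
    exact add_le_add (le_max_left _ _) (le_max_right _ _)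
  refine hmax.trans ?_
  rw [ENNReal.mul_rpow_of_nonneg _ _ hα]
  refine mul_le_mul_right ?_ _
  rcases le_total x y with h | h
  · rw [max_eq_right h]; exact le_add_self
  · rw [max_eq_left h]; exact le_self_add

theorem weighted_lintegral_conv_sq_le (d : ℕ) (hd : 1 ≤ d) {α : ℝ} (lam : ℝ) (hα : 0 ≤ α)
    {F G : EuclideanSpace ℝ (Fin d) → ℝ≥0∞} (hF : Measurable F) (hG : Measurable G) :
    (∫⁻ ξ, (‖ξ‖ₑ ^ α * ∫⁻ ζ, ‖ζ‖ₑ ^ (lam - d) * (F (ξ - ζ) * G ζ)) ^ (2 : ℝ)) ^ ((1 : ℝ) / 2) ≤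
      2 ^ α * ((∫⁻ ξ, ‖ξ‖ₑ ^ (2 * α) * F ξ ^ (2 : ℝ)) ^ ((1 : ℝ) / 2) *
          (∫⁻ ζ, ‖ζ‖ₑ ^ (lam - d) * G ζ) +
        (∫⁻ ξ, F ξ ^ (2 : ℝ)) ^ ((1 : ℝ) / 2) * ∫⁻ ζ, ‖ζ‖ₑ ^ (lam + α - d) * G ζ) := by
  have : Nonempty (Fin d) := ⟨⟨0, hd⟩⟩
  have h2 : (2 : ℝ≥0∞) ^ α ≠ ⊤ := ENNReal.rpow_ne_top_of_nonneg hα (by simp)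
  set P : EuclideanSpace ℝ (Fin d) → ℝ≥0∞ := fun ξ => ‖ξ‖ₑ ^ α * F ξ with hPdef
  set W : EuclideanSpace ℝ (Fin d) → ℝ≥0∞ := fun ζ => ‖ζ‖ₑ ^ (lam - d) * G ζ with hWdef
  set V : EuclideanSpace ℝ (Fin d) → ℝ≥0∞ := fun ζ => ‖ζ‖ₑ ^ (lam + α - d) * G ζ with hVdef
  have hP : Measurable P := by fun_prop
  have hW : Measurable W := by fun_prop
  have hV : Measurable V := by fun_prop
  have hpt : ∀ ξ, ‖ξ‖ₑ ^ α * ∫⁻ ζ, ‖ζ‖ₑ ^ (lam - d) * (F (ξ - ζ) * G ζ) ≤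
      2 ^ α * ((∫⁻ ζ, P (ξ - ζ) * W ζ) + ∫⁻ ζ, F (ξ - ζ) * V ζ) := by
    intro ξ
    rw [← lintegral_const_mul' _ _ (ENNReal.rpow_ne_top_of_nonneg hα enorm_ne_top),
      ← lintegral_add_left (by fun_prop), ← lintegral_const_mul' _ _ h2]
    refine lintegral_mono_ae ?_
    filter_upwards [Measure.ae_ne volume (0 : EuclideanSpace ℝ (Fin d))] with ζ hζ
    have hle : ‖ξ‖ₑ ^ α ≤ 2 ^ α * (‖ξ - ζ‖ₑ ^ α + ‖ζ‖ₑ ^ α) := by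
      refine le_trans (ENNReal.rpow_le_rpow ?_ hα) (add_rpow_le_two_rpow_mul _ _ hα)
      simpa using enorm_add_le (ξ - ζ) ζ
    have hV' : V ζ = ‖ζ‖ₑ ^ α * ‖ζ‖ₑ ^ (lam - d) * G ζ := by
      rw [hVdef, ← ENNReal.rpow_add _ _ (by simpa using hζ) enorm_ne_top]
      ring_nf
    rw [hV']
    refine (mul_le_mul_left hle _).trans (le_of_eq ?_)
    simp only [hPdef, hWdef]
    ring
  have hm1 : Measurable fun ξ => ∫⁻ ζ, P (ξ - ζ) * W ζ :=
    Measurable.lintegral_prod_right' (f := fun p => P (p.1 - p.2) * W p.2) (by fun_prop)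
  have hm2 : Measurable fun ξ => ∫⁻ ζ, F (ξ - ζ) * V ζ :=
    Measurable.lintegral_prod_right' (f := fun p => F (p.1 - p.2) * V p.2) (by fun_prop)
  calc _ ≤ (∫⁻ ξ, (2 ^ α * ((∫⁻ ζ, P (ξ - ζ) * W ζ) + ∫⁻ ζ, F (ξ - ζ) * V ζ)) ^ (2 : ℝ)) ^
          ((1 : ℝ) / 2) :=
        ENNReal.rpow_le_rpow (lintegral_mono fun ξ => ENNReal.rpow_le_rpow (hpt ξ) zero_le_two)
          (by norm_num)
    _ = 2 ^ α * (∫⁻ ξ, ((∫⁻ ζ, P (ξ - ζ) * W ζ) + ∫⁻ ζ, F (ξ - ζ) * V ζ) ^ (2 : ℝ)) ^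
          ((1 : ℝ) / 2) := by
        simp_rw [ENNReal.mul_rpow_of_nonneg _ _ (zero_le_two (α := ℝ))]
        rw [lintegral_const_mul' _ _ (ENNReal.rpow_ne_top_of_nonneg zero_le_two h2),
          ENNReal.mul_rpow_of_nonneg _ _ (by norm_num : (0 : ℝ) ≤ 1 / 2),
          ← ENNReal.rpow_mul (2 ^ α), mul_one_div_cancel two_ne_zero, ENNReal.rpow_one]
    _ ≤ 2 ^ α * ((∫⁻ ξ, (∫⁻ ζ, P (ξ - ζ) * W ζ) ^ (2 : ℝ)) ^ ((1 : ℝ) / 2) +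
          (∫⁻ ξ, (∫⁻ ζ, F (ξ - ζ) * V ζ) ^ (2 : ℝ)) ^ ((1 : ℝ) / 2)) :=
        mul_le_mul_right (ENNReal.lintegral_Lp_add_le hm1.aemeasurable hm2.aemeasurable
          one_le_two) _
    _ ≤ 2 ^ α * ((∫⁻ ξ, P ξ ^ (2 : ℝ)) ^ ((1 : ℝ) / 2) * (∫⁻ ζ, W ζ) +
          (∫⁻ ξ, F ξ ^ (2 : ℝ)) ^ ((1 : ℝ) / 2) * ∫⁻ ζ, V ζ) :=
        mul_le_mul_right (add_le_add (lintegral_conv_sq_le d hP hW)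
          (lintegral_conv_sq_le d hF hV)) _
    _ = _ := by
        have hP2 : ∀ ξ, P ξ ^ (2 : ℝ) = ‖ξ‖ₑ ^ (2 * α) * F ξ ^ (2 : ℝ) := fun ξ => by
          rw [hPdef, ENNReal.mul_rpow_of_nonneg _ _ zero_le_two, ← ENNReal.rpow_mul, mul_comm α]
        simp_rw [hP2]

theorem memLp_two_of_integrable_of_He_ne_top (d : ℕ) (hd : 1 ≤ d) {α : ℝ} (hα : 0 ≤ α)
    {g : EuclideanSpace ℝ (Fin d) → ℂ} (hg : Integrable g) (hA : He d α g ≠ ⊤) : MemLp g 2 := by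
  have hd' : (1 : ℝ) ≤ d := by exact_mod_cast hd
  have hcg := continuous_fourier_of_integrable d hg
  obtain ⟨C, hC, h⟩ := exists_lintegral_sq_le d hd hα
  have hle := h (fun ξ => ‖𝓕 g ξ‖ₑ) _ _ hcg.measurable.enorm (enorm_fourier_le d g) hg.2.ne
    rfl hA
  refine memLp_two_of_memLp_two_fourier d hg ⟨hcg.aestronglyMeasurable, ?_⟩
  rw [eLpNorm_eq_lintegral_rpow_enorm_toReal (by simp) (by simp)]
  simp only [ENNReal.toReal_ofNat]
  refine hle.trans_lt (ENNReal.mul_lt_top hC.lt_top (ENNReal.mul_lt_top ?_ ?_))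
  · refine ENNReal.rpow_lt_top_of_nonneg ?_ hg.2.ne
    rw [sub_nonneg, div_le_one (by linarith)]
    linarith
  · exact ENNReal.rpow_lt_top_of_nonneg (by positivity) hA

theorem stmt11 (d : ℕ) (hd : 1 ≤ d) (lam α : ℝ) (hlam0 : 0 < lam)
    (hlamd : lam < (d : ℝ) / 2) (hα : 0 ≤ α) (b : ℝ → ℝ) (hb : ∀ x, 0 ≤ b x) :
    ∃ C : ℝ≥0, 0 < C ∧ ∀ f g : EuclideanSpace ℝ (Fin d) → ℂ,
      Integrable f → Integrable g → He d α f ≠ ⊤ → He d α g ≠ ⊤ →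
      ∀ k : EuclideanSpace ℝ (Fin d), ‖k‖ = 1 →
        He d α (Qminus d (bL1 d b k).toReal lam f g) ≤
          C * bL1 d b k *
            (He d α f * L1e d g ^ (1 - 2 * lam / ((d : ℝ) + 2 * α)) *
                He d α g ^ (2 * lam / ((d : ℝ) + 2 * α)) +
              L1e d f ^ (1 - (d : ℝ) / ((d : ℝ) + 2 * α)) *
                He d α f ^ ((d : ℝ) / ((d : ℝ) + 2 * α)) *
                L1e d g ^ (1 - (2 * lam + 2 * α) / ((d : ℝ) + 2 * α)) *
                He d α g ^ ((2 * lam + 2 * α) / ((d : ℝ) + 2 * α))) := by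
  obtain ⟨C₀, hC₀, hQ⟩ := exists_enorm_fourier_Qminus_le d hd hlam0 hlamd
  obtain ⟨C₁, hC₁, hR₁⟩ := exists_lintegral_riesz_le d hd (α := α) hlam0 (by linarith)
  obtain ⟨C₂, hC₂, hS⟩ := exists_lintegral_sq_le d hd hα
  obtain ⟨C₃, hC₃, hR₃⟩ := exists_lintegral_riesz_le d hd (α := α) (μ := lam + α)
    (by linarith) (by linarith)
  have h2 : (2 : ℝ≥0∞) ^ α ≠ ⊤ := ENNReal.rpow_ne_top_of_nonneg hα (by simp)
  have hCt : C₀ * 2 ^ α * (C₁ + C₂ * C₃) ≠ ⊤ :=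
    ENNReal.mul_ne_top (ENNReal.mul_ne_top hC₀ h2)
      (ENNReal.add_ne_top.2 ⟨hC₁, ENNReal.mul_ne_top hC₂ hC₃⟩)
  refine ⟨(C₀ * 2 ^ α * (C₁ + C₂ * C₃)).toNNReal + 1, by positivity,
    fun f g hf hg hAf hAg k _ => ?_⟩
  have hcf := (continuous_fourier_of_integrable d hf).measurable.enorm
  have hcg := (continuous_fourier_of_integrable d hg).measurable.enorm
  have hg2 := memLp_two_of_integrable_of_He_ne_top d hd hα hg hAg
  have e₁ := hR₁ (fun ξ => ‖𝓕 g ξ‖ₑ) (L1e d g) (He d α g) hcg (enorm_fourier_le d g) hg.2.ne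
    rfl hAg
  have e₂ := hS (fun ξ => ‖𝓕 f ξ‖ₑ) (L1e d f) (He d α f) hcf (enorm_fourier_le d f) hf.2.ne
    rfl hAf
  have e₃ := hR₃ (fun ξ => ‖𝓕 g ξ‖ₑ) (L1e d g) (He d α g) hcg (enorm_fourier_le d g) hg.2.ne
    rfl hAg
  rw [mul_add 2 lam α] at e₃
  set B := bL1 d b k
  set N : EuclideanSpace ℝ (Fin d) → ℝ≥0∞ := fun ξ =>
    ∫⁻ ζ, ‖ζ‖ₑ ^ (lam - d) * (‖𝓕 f (ξ - ζ)‖ₑ * ‖𝓕 g ζ‖ₑ) with hN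
  have hpt : ∀ ξ, ‖𝓕 (Qminus d B.toReal lam f g) ξ‖ₑ ≤ C₀ * ENNReal.ofReal B.toReal * N ξ :=
    hQ _ f g ENNReal.toReal_nonneg hf hg hg2
  have hKt : C₀ * ENNReal.ofReal B.toReal ≠ ⊤ := ENNReal.mul_ne_top hC₀ ofReal_ne_top
  have hhe : He d α (Qminus d B.toReal lam f g) ≤
      C₀ * ENNReal.ofReal B.toReal *
        (∫⁻ ξ, (‖ξ‖ₑ ^ α * N ξ) ^ (2 : ℝ)) ^ ((1 : ℝ) / 2) := by
    calc He d α (Qminus d B.toReal lam f g)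
        ≤ (∫⁻ ξ, (C₀ * ENNReal.ofReal B.toReal) ^ (2 : ℝ) * (‖ξ‖ₑ ^ α * N ξ) ^ (2 : ℝ)) ^
            ((1 : ℝ) / 2) := by
          refine ENNReal.rpow_le_rpow (lintegral_mono fun ξ => ?_) (by norm_num)
          refine (mul_le_mul_right (ENNReal.rpow_le_rpow (hpt ξ) zero_le_two) _).trans
            (le_of_eq ?_)
          change ‖ξ‖ₑ ^ (2 * α) * _ = _
          rw [ENNReal.mul_rpow_of_nonneg _ _ zero_le_two,
            ENNReal.mul_rpow_of_nonneg (‖ξ‖ₑ ^ α) _ zero_le_two, ← ENNReal.rpow_mul, mul_comm α 2]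
          ring
      _ = _ := by
          rw [lintegral_const_mul' _ _ (ENNReal.rpow_ne_top_of_nonneg zero_le_two hKt),
            ENNReal.mul_rpow_of_nonneg _ _ (by norm_num : (0 : ℝ) ≤ 1 / 2), ← ENNReal.rpow_mul,
            mul_one_div_cancel two_ne_zero, ENNReal.rpow_one]
  have hconv := weighted_lintegral_conv_sq_le d hd lam hα hcf hcg
  have hC : C₀ * 2 ^ α * (C₁ + C₂ * C₃) ≤
      (((C₀ * 2 ^ α * (C₁ + C₂ * C₃)).toNNReal + 1 : ℝ≥0) : ℝ≥0∞) := by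
    rw [ENNReal.coe_add, ENNReal.coe_toNNReal hCt]
    exact le_self_add
  set T₁ := L1e d g ^ (1 - 2 * lam / ((d : ℝ) + 2 * α)) * He d α g ^ (2 * lam / ((d : ℝ) + 2 * α))
    with hT₁
  set T₂ := L1e d f ^ (1 - (d : ℝ) / ((d : ℝ) + 2 * α)) *
    He d α f ^ ((d : ℝ) / ((d : ℝ) + 2 * α)) with hT₂
  set T₃ := L1e d g ^ (1 - (2 * lam + 2 * α) / ((d : ℝ) + 2 * α)) *
    He d α g ^ ((2 * lam + 2 * α) / ((d : ℝ) + 2 * α)) with hT₃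
  rw [mul_assoc (He d α f), ← hT₁, mul_assoc T₂, ← hT₃]
  calc He d α (Qminus d B.toReal lam f g)
      ≤ C₀ * B * (2 ^ α * (He d α f * (C₁ * T₁) + C₂ * T₂ * (C₃ * T₃))) :=
        hhe.trans (mul_le_mul' (mul_le_mul_right ENNReal.ofReal_toReal_le _)
          (hconv.trans (mul_le_mul_right (add_le_add (mul_le_mul_right e₁ _)
            (mul_le_mul' e₂ e₃)) _)))
    _ = C₀ * 2 ^ α * B * (C₁ * (He d α f * T₁) + C₂ * C₃ * (T₂ * T₃)) := by ring
    _ ≤ C₀ * 2 ^ α * B * ((C₁ + C₂ * C₃) * (He d α f * T₁) + (C₁ + C₂ * C₃) * (T₂ * T₃)) :=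
        mul_le_mul_right (add_le_add (mul_le_mul_left le_self_add _)
          (mul_le_mul_left le_add_self _)) _
    _ = C₀ * 2 ^ α * (C₁ + C₂ * C₃) * B * (He d α f * T₁ + T₂ * T₃) := by ring
    _ ≤ _ := mul_le_mul_left (mul_le_mul_left hC _) _
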